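/- arXiv:1505.05241 — 7 statements merged into one kernel-verified Lean document; each statement's English description precedes it below -/
import Mathlib

section
/- Let n, ℓ ≥ 1, let A be the n×(n+ℓ) integer matrix with columns a_1, …, a_{n+ℓ} ∈ ℤ^n, and suppose the subgroup ℤA of ℤ^n generated by the columns has finite odd index in ℤ^n. Let C be a real n×(n+ℓ) matrix of rank n, b ∈ ℝ^n, and F(x)_i = Σ_{k=1}^{n+ℓ} C_{i,k} x^{a_k} for x ∈ (ℝ∖{0})^n. Let β^{(1)}, …, β^{(ℓ)} be a ℤ-basis of the lattice {β ∈ ℤ^{n+ℓ} : Aβ = 0}, let L : ℝ^ℓ → ℝ^{n+ℓ} be an injective linear map with components L_i and C ∘ L = 0, and let λ ∈ ℝ^{n+ℓ} satisfy Cλ = b. Then the relation {(x, y) : x^{a_i} = L_i(y) + λ_i for all i} defines a bijection between {x ∈ (ℝ∖{0})^n : F(x) = b} and {y ∈ ℝ^ℓ : L_i(y) + λ_i ≠ 0 for all i, and ∏_{i=1}^{n+ℓ} (L_i(y) + λ_i)^{β^{(j)}_i} = 1 for j = 1, …, ℓ}. -/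
/-- Over `ℝ` every odd power map is surjective. -/
theorem Real.exists_pow_eq_of_odd {N : ℕ} (hN : Odd N) (c : ℝ) : ∃ r : ℝ, r ^ N = c := by
  rcases le_total 0 c with hc | hc
  · exact ⟨c ^ (N : ℝ)⁻¹, Real.rpow_inv_natCast_pow hc hN.pos.ne'⟩
  · exact ⟨-(-c) ^ (N : ℝ)⁻¹, by
      rw [hN.neg_pow, Real.rpow_inv_natCast_pow (neg_nonneg.2 hc) hN.pos.ne', neg_neg]⟩

theorem zpow_sum₀ {G ι : Type*} [CommGroupWithZero G] {a : G} (ha : a ≠ 0) (s : Finset ι)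
    (f : ι → ℤ) : a ^ ∑ i ∈ s, f i = ∏ i ∈ s, a ^ f i := by
  classical
  induction s using Finset.induction_on with
  | empty => simp
  | insert i s hi ih => rw [Finset.sum_insert hi, Finset.prod_insert hi, zpow_add₀ ha, ih]

/-- The monomial map `v ↦ ∏ i, z i ^ v i` turns finite integer combinations of exponent vectors
into products of powers. -/
theorem prod_zpow_sum_mul {K ι κ : Type*} [Field K] [Fintype ι] [Fintype κ] {z : ι → K}
    (hz : ∀ i, z i ≠ 0) (w : κ → ι → ℤ) (c : κ → ℤ) :
    ∏ i, z i ^ (∑ k, w k i * c k) = ∏ k, (∏ i, z i ^ w k i) ^ c k := by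
  simp_rw [zpow_sum₀ (hz _), zpow_mul, ← Finset.prod_zpow]
  exact Finset.prod_comm

/-- Substituting the monomials `x ^ a_k` into the monomial with exponent `v` gives the monomial
with exponent `A v`. -/
theorem prod_zpow_mulVec {K ι κ : Type*} [Field K] [Fintype ι] [Fintype κ] {x : ι → K}
    (hx : ∀ i, x i ≠ 0) (A : Matrix ι κ ℤ) (v : κ → ℤ) :
    ∏ i, x i ^ A.mulVec v i = ∏ k, (∏ i, x i ^ A i k) ^ v k :=
  prod_zpow_sum_mul hx (fun k i ↦ A i k) v

/-- The index of the lattice spanned by the columns multiplies every integer vector into the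
image of the matrix. -/
theorem Matrix.exists_mulVec_eq_index_smul {ι κ : Type*} [Fintype κ] [DecidableEq κ]
    (A : Matrix ι κ ℤ) (u : ι → ℤ) :
    ∃ v : κ → ℤ, A.mulVec v =
      (AddSubgroup.closure (Set.range fun k => fun i => A i k)).index • u := by
  have hle : AddSubgroup.closure (Set.range fun k => fun i => A i k) ≤
      A.mulVecLin.toAddMonoidHom.range := by
    rw [AddSubgroup.closure_le]
    rintro _ ⟨k, rfl⟩
    exact ⟨Pi.single k 1, by simp [Matrix.col_def]; rfl⟩
  obtain ⟨v, hv⟩ := hle (AddSubgroup.nsmul_index_mem _ u)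
  exact ⟨v, hv⟩

/-- If the columns of `A` span a lattice of odd index, a point `z` of the real torus is the image
of a unique point under the monomial map with exponents the columns of `A` as soon as `z`
satisfies the multiplicative relations given by the integer kernel of `A`. -/
theorem existsUnique_prod_zpow_eq {ι κ : Type*} [Fintype ι] [Fintype κ] (A : Matrix ι κ ℤ)
    (hA : Odd (AddSubgroup.closure (Set.range fun k => fun i => A i k)).index)
    {z : κ → ℝ} (hz : ∀ k, z k ≠ 0)
    (hker : ∀ v : κ → ℤ, A.mulVec v = 0 → ∏ k, z k ^ v k = 1) :
    ∃! x : ι → ℝ, (∀ i, x i ≠ 0) ∧ ∀ k, ∏ i, x i ^ A i k = z k := by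
  classical
  choose v hv using fun i ↦ A.exists_mulVec_eq_index_smul (Pi.single i 1)
  set N := (AddSubgroup.closure (Set.range fun k => fun i => A i k)).index
  choose x hx using fun i ↦ Real.exists_pow_eq_of_odd hA (∏ k, z k ^ v i k)
  have hx0 : ∀ i, x i ≠ 0 := fun i h ↦ by
    have h' := hx i
    rw [h, zero_pow hA.pos.ne'] at h'
    exact Finset.prod_ne_zero_iff.2 (fun k _ ↦ zpow_ne_zero _ (hz k)) h'.symm
  refine ⟨x, ⟨hx0, fun k ↦ hA.strictMono_pow.injective ?_⟩,
    fun x' ⟨hx'0, hx'⟩ ↦ funext fun i ↦ hA.strictMono_pow.injective ?_⟩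
  · have hrel : A.mulVec (∑ i, A i k • v i - N • Pi.single k 1) = 0 := by
      ext j
      simp only [Matrix.mulVec_sub, Matrix.mulVec_sum, Matrix.mulVec_smul, hv]
      simp [Finset.sum_apply, Pi.single_apply, mul_comm]
    have h := hker _ hrel
    simp_rw [Pi.sub_apply, zpow_sub₀ (hz _), Finset.prod_div_distrib] at h
    have hpow : ∏ l, z l ^ (N • (Pi.single k 1 : κ → ℤ)) l = z k ^ N := by
      rw [Finset.prod_eq_single k] <;> simp +contextual
    rw [hpow, div_eq_one_iff_eq (pow_ne_zero _ (hz k))] at h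
    have hcomb := prod_zpow_sum_mul hz v fun i ↦ A i k
    simp only [Finset.sum_apply, Pi.smul_apply, smul_eq_mul, mul_comm] at h hcomb
    simp only [← h, hcomb, ← hx, ← Finset.prod_pow]
    exact Finset.prod_congr rfl fun i _ ↦ by
      rw [← zpow_natCast, ← zpow_natCast, zpow_comm]
  · have h := prod_zpow_mulVec hx'0 A (v i)
    simp only [hv, hx', ← hx] at h
    rw [← h, Finset.prod_eq_single i]
    · simp
    · intro j _ hj
      simp [hj]
    · simp

/-- An injective linear map into the kernel of `f` with the dimension prescribed by rank-nullity
has range equal to that kernel. -/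
theorem LinearMap.range_eq_ker_of_finrank {K U V W : Type*} [Field K] [AddCommGroup U] [Module K U]
    [AddCommGroup V] [Module K V] [FiniteDimensional K V] [AddCommGroup W] [Module K W]
    {g : U →ₗ[K] V} {f : V →ₗ[K] W} (hg : Function.Injective g) (hfg : ∀ u, f (g u) = 0)
    (hdim : Module.finrank K (LinearMap.range f) + Module.finrank K U = Module.finrank K V) :
    LinearMap.range g = LinearMap.ker f := by
  refine Submodule.eq_of_le_of_finrank_eq ?_ ?_
  · rintro _ ⟨u, rfl⟩
    exact hfg u
  · have := f.finrank_range_add_finrank_ker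
    rw [LinearMap.finrank_range_of_inj hg]
    omega

/-- Gale duality for nonzero real solutions: when the lattice ℤA spanned by
the exponent vectors has finite odd index in ℤ^n, the solutions of F(x) = b in the real
torus (ℝ∖{0})^n are in bijection with the solutions of the Gale system of master functions
in the complement of the hyperplane arrangement, via the relation x^{a_i} = L_i(y) + λ_i. -/
theorem gale_duality_real_torus
    (n ℓ : ℕ) (hn : 1 ≤ n) (hℓ : 1 ≤ ℓ)
    (A : Matrix (Fin n) (Fin (n + ℓ)) ℤ)
    (hoddindex : Odd (AddSubgroup.closure (Set.range fun k => fun i => A i k)).index)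
    (hfinindex : (AddSubgroup.closure (Set.range fun k => fun i => A i k)).index ≠ 0)
    (C : Matrix (Fin n) (Fin (n + ℓ)) ℝ) (hCrank : C.rank = n)
    (b : Fin n → ℝ)
    (β : Fin ℓ → Fin (n + ℓ) → ℤ)
    (hβker : ∀ j, A.mulVec (β j) = 0)
    (hβbasis : ∀ v : Fin (n + ℓ) → ℤ, A.mulVec v = 0 →
      ∃! cc : Fin ℓ → ℤ, v = ∑ j, cc j • β j)
    (L : (Fin ℓ → ℝ) →ₗ[ℝ] (Fin (n + ℓ) → ℝ))
    (hLinj : Function.Injective L)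
    (hCL : ∀ y, C.mulVec (L y) = 0)
    (lam : Fin (n + ℓ) → ℝ) (hlam : C.mulVec lam = b) :
    (∀ x : Fin n → ℝ, (∀ j, x j ≠ 0) →
      (∀ i, ∑ k, C i k * ∏ j, x j ^ A j k = b i) →
      ∃! y : Fin ℓ → ℝ,
        (∀ k : Fin (n + ℓ), ∏ j, x j ^ A j k = L y k + lam k) ∧
        (∀ k, L y k + lam k ≠ 0) ∧
        (∀ j, ∏ k, (L y k + lam k) ^ β j k = 1)) ∧
    (∀ y : Fin ℓ → ℝ, (∀ k, L y k + lam k ≠ 0) →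
      (∀ j, ∏ k, (L y k + lam k) ^ β j k = 1) →
      ∃! x : Fin n → ℝ, (∀ j, x j ≠ 0) ∧
        (∀ i, ∑ k, C i k * ∏ j, x j ^ A j k = b i) ∧
        (∀ k : Fin (n + ℓ), ∏ j, x j ^ A j k = L y k + lam k)) := by
  have hrange : LinearMap.range L = LinearMap.ker C.mulVecLin :=
    LinearMap.range_eq_ker_of_finrank hLinj hCL (by
      change C.rank + _ = _
      simp [hCrank])
  refine ⟨fun x hx hF ↦ ?_, fun y hy hyβ ↦ ?_⟩
  · obtain ⟨y, hy⟩ : (fun k ↦ ∏ j, x j ^ A j k) - lam ∈ LinearMap.range L := by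
      rw [hrange, LinearMap.mem_ker, map_sub, sub_eq_zero]
      exact (funext hF).trans hlam.symm
    have hyk : ∀ k, ∏ j, x j ^ A j k = L y k + lam k := fun k ↦ by simp [hy]
    refine ⟨y, ⟨hyk, fun k ↦ ?_, fun j ↦ ?_⟩, fun y' ⟨hy', _⟩ ↦ hLinj (funext fun k ↦ ?_)⟩
    · rw [← hyk]
      exact Finset.prod_ne_zero_iff.2 fun j _ ↦ zpow_ne_zero _ (hx j)
    · simp_rw [← hyk, ← prod_zpow_mulVec hx, hβker]
      simp
    · linarith [hyk k, hy' k]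
  · obtain ⟨x, ⟨hx0, hx⟩, hunique⟩ := existsUnique_prod_zpow_eq A hoddindex hy fun v hv ↦ by
      obtain ⟨c, rfl, _⟩ := hβbasis v hv
      have h := prod_zpow_sum_mul hy β c
      simpa [hyβ, mul_comm] using h
    refine ⟨x, ⟨hx0, fun i ↦ ?_, hx⟩, fun x' ⟨hx'0, _, hx'⟩ ↦ hunique x' ⟨hx'0, hx'⟩⟩
    have h : C.mulVec (L y + lam) = b := by rw [Matrix.mulVec_add, hCL, hlam, zero_add]
    simp only [hx]
    exact congrFun h i
end

section
/- Let L_1, …, L_N and L be linear forms on ℝ^ℓ, let λ ∈ ℝ^N, set Λ_i(y) := L_i(y) + λ_i, and let Δ := {y ∈ ℝ^ℓ : Λ_i(y) > 0 for all i = 1, …, N}. Assume 1 + L(y) > 0 for every y ∈ Δ. Define Λ̄_0(z) := 1 − L(z), Λ̄_i(z) := L_i(z) + λ_i(1 − L(z)) for i = 1, …, N, and Δ̄ := {z ∈ ℝ^ℓ : Λ̄_i(z) > 0 for i = 0, 1, …, N}. Then the map π(y) := y/(1 + L(y)) is a bijection from Δ onto Δ̄ with inverse z ↦ z/(1 − L(z)),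 and for every β ∈ ℤ^N, setting β_0 := −Σ_{i=1}^N β_i, one has ∏_{i=0}^N Λ̄_i(π(y))^{β_i} = ∏_{i=1}^N Λ_i(y)^{β_i} for all y ∈ Δ. In particular, y ∈ Δ satisfies ∏_{i=1}^N Λ_i(y)^{β_i} = 1 if and only if z = π(y) ∈ Δ̄ satisfies ∏_{i=0}^N Λ̄_i(z)^{β_i} = 1. -/
theorem Finset.prod_zpow_eq_zpow_sum_of_ne_zero {ι G : Type*} [CommGroupWithZero G] (s : Finset ι)
    (f : ι → ℤ) {a : G} (ha : a ≠ 0) : ∏ i ∈ s, a ^ f i = a ^ ∑ i ∈ s, f i := by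
  classical
  induction s using Finset.induction_on with
  | empty => simp
  | insert i s hi ih => rw [prod_insert hi, sum_insert hi, zpow_add₀ ha, ih]


/-- The projective coordinate change y ↦ y/(1 + L(y)) maps the chamber Δ
bijectively onto the chamber Δ̄ (with inverse z ↦ z/(1 − L(z))), and transforms the master
functions accordingly: with β₀ := −Σ βᵢ, the transformed master function agrees with the
original one, so solutions correspond to solutions. -/
theorem projective_coordinate_change
    (ℓ N : ℕ)
    (L : Fin N → (Fin ℓ → ℝ) →ₗ[ℝ] ℝ) (L0 : (Fin ℓ → ℝ) →ₗ[ℝ] ℝ)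
    (lam : Fin N → ℝ)
    (Δ : Set (Fin ℓ → ℝ)) (hΔ : Δ = {y | ∀ i, 0 < L i y + lam i})
    (hpos : ∀ y ∈ Δ, 0 < 1 + L0 y)
    (Δbar : Set (Fin ℓ → ℝ))
    (hΔbar : Δbar = {z | 0 < 1 - L0 z ∧ ∀ i, 0 < L i z + lam i * (1 - L0 z)})
    (π : (Fin ℓ → ℝ) → (Fin ℓ → ℝ)) (hπ : ∀ y, π y = (1 + L0 y)⁻¹ • y) :
    Set.BijOn π Δ Δbar ∧
    (∀ y ∈ Δ, (1 - L0 (π y))⁻¹ • π y = y) ∧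
    (∀ z ∈ Δbar, π ((1 - L0 z)⁻¹ • z) = z) ∧
    (∀ β : Fin N → ℤ, ∀ y ∈ Δ,
      (1 - L0 (π y)) ^ (-(∑ i, β i)) *
          ∏ i, (L i (π y) + lam i * (1 - L0 (π y))) ^ β i =
        ∏ i, (L i y + lam i) ^ β i) ∧
    (∀ β : Fin N → ℤ, ∀ y ∈ Δ,
      ((∏ i, (L i y + lam i) ^ β i = 1) ↔
        (1 - L0 (π y)) ^ (-(∑ i, β i)) *
          ∏ i, (L i (π y) + lam i * (1 - L0 (π y))) ^ β i = 1)) := by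
  have one_sub (y) (hy : y ∈ Δ) : 1 - L0 (π y) = (1 + L0 y)⁻¹ := by
    have := (hpos y hy).ne'
    simp only [hπ, map_smul, smul_eq_mul]
    field_simp
    ring
  have form_eq (y) (hy : y ∈ Δ) (i) :
      L i (π y) + lam i * (1 - L0 (π y)) = (1 + L0 y)⁻¹ * (L i y + lam i) := by
    rw [one_sub y hy, hπ, map_smul, smul_eq_mul]
    ring
  have left_inv : ∀ y ∈ Δ, (1 - L0 (π y))⁻¹ • π y = y := fun y hy => by
    rw [one_sub y hy, hπ, inv_inv, smul_inv_smul₀ (hpos y hy).ne']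
  have right_inv : ∀ z ∈ Δbar, π ((1 - L0 z)⁻¹ • z) = z := fun z hz => by
    rw [hΔbar] at hz
    have hz0 := hz.1.ne'
    have one_add : 1 + L0 ((1 - L0 z)⁻¹ • z) = (1 - L0 z)⁻¹ := by
      simp only [map_smul, smul_eq_mul]
      field_simp
      ring
    rw [hπ, one_add, inv_inv, smul_inv_smul₀ hz0]
  have maps : Set.MapsTo π Δ Δbar := fun y hy => by
    have hinv := inv_pos.2 (hpos y hy)
    rw [hΔbar]
    refine ⟨by rwa [one_sub y hy], fun i => ?_⟩
    rw [form_eq y hy]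
    rw [hΔ] at hy
    exact mul_pos hinv (hy i)
  have maps_inv : Set.MapsTo (fun z => (1 - L0 z)⁻¹ • z) Δbar Δ := fun z hz => by
    rw [hΔbar] at hz
    rw [hΔ]
    intro i
    have hz0 := hz.1.ne'
    have form_inv : L i ((1 - L0 z)⁻¹ • z) + lam i =
        (1 - L0 z)⁻¹ * (L i z + lam i * (1 - L0 z)) := by
      rw [map_smul, smul_eq_mul]
      field_simp
    exact form_inv ▸ mul_pos (inv_pos.2 hz.1) (hz.2 i)
  have master_eq : ∀ β : Fin N → ℤ, ∀ y ∈ Δ,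
      (1 - L0 (π y)) ^ (-(∑ i, β i)) *
          ∏ i, (L i (π y) + lam i * (1 - L0 (π y))) ^ β i =
        ∏ i, (L i y + lam i) ^ β i := fun β y hy => by
    have ht : (1 + L0 y)⁻¹ ≠ 0 := inv_ne_zero (hpos y hy).ne'
    simp only [form_eq y hy, mul_zpow, Finset.prod_mul_distrib]
    rw [one_sub y hy, Finset.prod_zpow_eq_zpow_sum_of_ne_zero _ _ ht, ← mul_assoc, ← zpow_add₀ ht,
      neg_add_cancel, zpow_zero, one_mul]
  have inv_on : Set.InvOn (fun z => (1 - L0 z)⁻¹ • z) π Δ Δbar :=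
    ⟨fun y hy => left_inv y hy, fun z hz => right_inv z hz⟩
  exact ⟨inv_on.bijOn maps maps_inv, left_inv, right_inv, master_eq,
    fun β y hy => by rw [master_eq β y hy]⟩
end

section
/- Let C be a real n×(n+ℓ) matrix of rank n, let L : ℝ^ℓ → ℝ^{n+ℓ} be an injective linear map with C ∘ L = 0 and components L_i, and let λ ∈ ℝ^{n+ℓ}. Suppose the chamber Δ := {y ∈ ℝ^ℓ : L_i(y) + λ_i > 0 for all i = 1, …, n+ℓ} is nonempty. Then Δ is unbounded if and only if there exists a nonzero vector v ∈ ℝ^{n+ℓ} with all coordinates nonnegative such that Cv = 0. -/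
open Filter Topology

/-- The set of solutions of finitely many strict affine inequalities is unbounded only if it has
a nonzero recession direction. -/
theorem exists_recession_direction_of_not_isBounded {E ι : Type*} [NormedAddCommGroup E]
    [NormedSpace ℝ E] [FiniteDimensional ℝ E] (L : E →ₗ[ℝ] (ι → ℝ)) (lam : ι → ℝ)
    (h : ¬ Bornology.IsBounded {y : E | ∀ i, 0 < L y i + lam i}) :
    ∃ d : E, d ≠ 0 ∧ ∀ i, 0 ≤ L d i := by
  have hex : ∀ n : ℕ, ∃ y : E, (∀ i, 0 < L y i + lam i) ∧ (n : ℝ) < ‖y‖ := by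
    intro n
    by_contra! hn
    exact h (isBounded_iff_forall_norm_le.2 ⟨n, hn⟩)
  choose y hy hnorm using hex
  have hpos : ∀ n, 0 < ‖y n‖ := fun n => (Nat.cast_nonneg n).trans_lt (hnorm n)
  have hinv : Tendsto (fun n => ‖y n‖⁻¹) atTop (𝓝 0) :=
    tendsto_inv_atTop_zero.comp
      (tendsto_atTop_mono (fun n => (hnorm n).le) tendsto_natCast_atTop_atTop)
  have : ProperSpace E := FiniteDimensional.proper ℝ E
  obtain ⟨d, hd, φ, hφ, hlim⟩ := (isCompact_sphere (0 : E) 1).tendsto_subseq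
    (x := fun n => ‖y n‖⁻¹ • y n) (fun n => by
      simp [norm_smul, (hpos n).ne'])
  refine ⟨d, ne_zero_of_mem_unit_sphere ⟨d, hd⟩, fun i => ?_⟩
  have hcont : Continuous fun x => L x i :=
    ((LinearMap.proj i : (ι → ℝ) →ₗ[ℝ] ℝ).comp L).continuous_of_finiteDimensional
  have hsum := ((hcont.tendsto d).comp hlim).add
    ((hinv.comp hφ.tendsto_atTop).mul_const (lam i))
  rw [zero_mul, add_zero] at hsum
  refine ge_of_tendsto' hsum fun n => ?_
  have := mul_pos (inv_pos.2 (hpos (φ n))) (hy (φ n) i)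
  simpa [mul_add] using this.le

/-- A nonempty set of solutions of strict affine inequalities with a nonzero recession direction
is unbounded. -/
theorem not_isBounded_of_recession_direction {E ι : Type*} [NormedAddCommGroup E]
    [NormedSpace ℝ E] (L : E →ₗ[ℝ] (ι → ℝ)) (lam : ι → ℝ)
    (hne : {y : E | ∀ i, 0 < L y i + lam i}.Nonempty) {d : E} (hd : d ≠ 0)
    (hLd : ∀ i, 0 ≤ L d i) :
    ¬ Bornology.IsBounded {y : E | ∀ i, 0 < L y i + lam i} := by
  obtain ⟨y, hy⟩ := hne
  intro hb
  obtain ⟨R, hR⟩ := isBounded_iff_forall_norm_le.1 hb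
  have hray : ∀ n : ℕ, n * ‖d‖ ≤ R + ‖y‖ := by
    intro n
    have hmem : ∀ i, 0 < L (y + (n : ℝ) • d) i + lam i := fun i => by
      have := mul_nonneg (Nat.cast_nonneg (α := ℝ) n) (hLd i)
      have := hy i
      simp only [map_add, map_smul, Pi.add_apply, Pi.smul_apply, smul_eq_mul]
      linarith
    calc n * ‖d‖ = ‖(y + (n : ℝ) • d) - y‖ := by simp [norm_smul]
      _ ≤ ‖y + (n : ℝ) • d‖ + ‖y‖ := norm_sub_le _ _
      _ ≤ R + ‖y‖ := by gcongr; exact hR _ hmem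
  obtain ⟨n, hn⟩ := exists_nat_gt ((R + ‖y‖) / ‖d‖)
  exact ((div_lt_iff₀ (norm_pos_iff.2 hd)).1 hn).not_ge (hray n)

/-- An injective linear map into the kernel of a matrix of full row rank is onto the kernel, if
the dimensions agree. -/
theorem range_eq_ker_mulVecLin {n l : ℕ} {C : Matrix (Fin n) (Fin (n + l)) ℝ}
    (hC : C.rank = n) {L : (Fin l → ℝ) →ₗ[ℝ] (Fin (n + l) → ℝ)}
    (hL : Function.Injective L) (hCL : ∀ y, C.mulVec (L y) = 0) :
    LinearMap.range L = LinearMap.ker C.mulVecLin := by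
  refine Submodule.eq_of_le_of_finrank_eq ?_ ?_
  · rintro _ ⟨y, rfl⟩
    simpa using hCL y
  · have hker := C.mulVecLin.finrank_range_add_finrank_ker
    have hrange := LinearMap.finrank_range_of_inj hL
    rw [Matrix.rank] at hC
    simp only [Module.finrank_fin_fun] at hker hrange
    omega


/-- The positive chamber Δ of the hyperplane arrangement arising from the Gale
transform is unbounded if and only if the coefficient matrix C annihilates a nonzero
nonnegative vector. -/
theorem chamber_unbounded_iff
    (n ℓ : ℕ)
    (C : Matrix (Fin n) (Fin (n + ℓ)) ℝ) (hCrank : C.rank = n)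
    (L : (Fin ℓ → ℝ) →ₗ[ℝ] (Fin (n + ℓ) → ℝ)) (hLinj : Function.Injective L)
    (hCL : ∀ y, C.mulVec (L y) = 0)
    (lam : Fin (n + ℓ) → ℝ)
    (hne : {y : Fin ℓ → ℝ | ∀ i, 0 < L y i + lam i}.Nonempty) :
    ¬ Bornology.IsBounded {y : Fin ℓ → ℝ | ∀ i, 0 < L y i + lam i} ↔
      ∃ v : Fin (n + ℓ) → ℝ, v ≠ 0 ∧ (∀ k, 0 ≤ v k) ∧ C.mulVec v = 0 := by
  constructor
  · intro h
    obtain ⟨d, hd, hLd⟩ := exists_recession_direction_of_not_isBounded L lam h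
    exact ⟨L d, (map_ne_zero_iff L hLinj).2 hd, hLd, hCL d⟩
  · rintro ⟨v, hv, hnonneg, hCv⟩
    have hmem : v ∈ LinearMap.range L := by
      rw [range_eq_ker_mulVecLin hCrank hLinj hCL]
      simpa using hCv
    obtain ⟨d, rfl⟩ := hmem
    exact not_isBounded_of_recession_direction L lam hne
      ((map_ne_zero_iff L hLinj).1 hv) hnonneg
end

section
/- Let U ⊆ ℝ^ℓ be open, let g_1, …, g_ℓ : U → ℝ be differentiable functions, and let γ : [a, b] → U (with a < b) be a differentiable curve with γ'(t) ≠ 0 for all t ∈ [a, b]. Suppose g_i(γ(t)) = 0 for all t ∈ [a, b] and all i = 1, …, ℓ−1, and that g_ℓ(γ(a)) = g_ℓ(γ(b)) = 0. Then there exists t ∈ (a, b) such that the Jacobian determinant J(g_1, …, g_ℓ) = det(∂g_i/∂y_j) vanishes at the point γ(t). -/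
/-- If continuous linear functionals share a nonzero kernel vector, then the determinant of
their coordinate matrix vanishes. -/
theorem Matrix.det_of_apply_single_eq_zero {n : Type*} [Fintype n] [DecidableEq n]
    (L : n → (n → ℝ) →L[ℝ] ℝ) {v : n → ℝ} (hv : v ≠ 0) (hL : ∀ i, L i v = 0) :
    Matrix.det (Matrix.of fun i j => L i (Pi.single j 1)) = 0 := by
  refine Matrix.exists_mulVec_eq_zero_iff.mp ⟨v, hv, funext fun i => ?_⟩
  rw [Pi.zero_apply, ← hL i]
  conv_rhs => rw [pi_eq_sum_univ' v, map_sum]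
  simp only [Matrix.mulVec, dotProduct, Matrix.of_apply, map_smul, smul_eq_mul]
  exact Finset.sum_congr rfl fun j _ => mul_comm _ _

/-- The key step behind the Khovanskii-Rolle Theorem: along a regular arc of
the curve cut out by g₁,…,g_{ℓ−1}, the Jacobian determinant of g₁,…,g_ℓ vanishes between
any two zeroes of g_ℓ. Here ℓ = m + 1. -/
theorem khovanskii_rolle_step
    (m : ℕ) (U : Set (Fin (m + 1) → ℝ)) (hU : IsOpen U)
    (g : Fin (m + 1) → (Fin (m + 1) → ℝ) → ℝ)
    (hg : ∀ i, DifferentiableOn ℝ (g i) U)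
    (a b : ℝ) (hab : a < b)
    (γ γ' : ℝ → Fin (m + 1) → ℝ)
    (hγU : ∀ t ∈ Set.Icc a b, γ t ∈ U)
    (hγd : ∀ t ∈ Set.Icc a b, HasDerivAt γ (γ' t) t)
    (hγ'ne : ∀ t ∈ Set.Icc a b, γ' t ≠ 0)
    (hzero : ∀ i : Fin m, ∀ t ∈ Set.Icc a b, g i.castSucc (γ t) = 0)
    (hlasta : g (Fin.last m) (γ a) = 0) (hlastb : g (Fin.last m) (γ b) = 0) :
    ∃ t ∈ Set.Ioo a b,
      Matrix.det (Matrix.of fun i j => fderiv ℝ (g i) (γ t) (Pi.single j 1)) = 0 := by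
  have hderiv : ∀ i, ∀ t ∈ Set.Icc a b,
      HasDerivAt (g i ∘ γ) (fderiv ℝ (g i) (γ t) (γ' t)) t := fun i t ht =>
    ((hg i).differentiableAt (hU.mem_nhds (hγU t ht))).hasFDerivAt.comp_hasDerivAt t (hγd t ht)
  obtain ⟨t, ht, hlast⟩ := exists_hasDerivAt_eq_zero hab
    (fun t ht => (hderiv (Fin.last m) t ht).continuousAt.continuousWithinAt)
    (hlasta.trans hlastb.symm)
    (fun t ht => hderiv (Fin.last m) t (Set.Ioo_subset_Icc_self ht))
  have htI := Set.Ioo_subset_Icc_self ht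
  refine ⟨t, ht, Matrix.det_of_apply_single_eq_zero _ (hγ'ne t htI) fun i => ?_⟩
  refine Fin.lastCases hlast (fun i => ?_) i
  have hev : g i.castSucc ∘ γ =ᶠ[nhds t] fun _ => 0 :=
    Filter.eventually_of_mem (Icc_mem_nhds ht.1 ht.2) (hzero i)
  exact (hderiv i.castSucc t htI).unique ((hasDerivAt_const t 0).congr_of_eventuallyEq hev)
end

section
/- Let Λ_i(y) = L_i(y) + λ_i for i = 1, …, N be affine forms on ℝ^ℓ and let β^{(1)}, …, β^{(m)} ∈ ℤ^N. Define Z := {y ∈ ℝ^ℓ : Λ_i(y) > 0 for all i, and ∏_{i=1}^N Λ_i(y)^{β^{(k)}_i} = 1 for all k = 1, …, m}. Suppose a point p ∈ ℝ^ℓ lies in the closure of Z and the set R := {i : Λ_i(p) = 0} of indices of affine forms vanishing at p is nonempty. Then there exist nonnegative real numbers (α_i)_{i∈R}, not all zero, such that Σ_{i∈R} α_i β^{(k)}_i = 0 for every k = 1, …, m. That is, the submatrix of the exponent matrix B = (β^{(k)}_i) consisting of the rows indexed by the affine forms vanishing at p annihilates a nonzero nonnegative row vector. -/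
open Filter Topology


/-- If a point p in the closure of the solution set Z of the first m master
functions in the positive chamber lies on some of the hyperplanes, then the rows of the
exponent matrix indexed by the affine forms vanishing at p annihilate a nonzero nonnegative
row vector. -/
theorem boundary_point_gives_nonnegative_relation
    (ℓ N m : ℕ)
    (L : Fin N → (Fin ℓ → ℝ) →ₗ[ℝ] ℝ) (lam : Fin N → ℝ)
    (β : Fin m → Fin N → ℤ)
    (p : Fin ℓ → ℝ)
    (hp : p ∈ closure {y : Fin ℓ → ℝ | (∀ i, 0 < L i y + lam i) ∧
      ∀ k, ∏ i, (L i y + lam i) ^ β k i = 1})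
    (hR : ∃ i, L i p + lam i = 0) :
    ∃ α : Fin N → ℝ, (∀ i, 0 ≤ α i) ∧ (∀ i, L i p + lam i ≠ 0 → α i = 0) ∧
      α ≠ 0 ∧ ∀ k, ∑ i, α i * (β k i : ℝ) = 0 := by
  classical
  obtain ⟨y, hy, hyp⟩ := mem_closure_iff_seq_limit.mp hp
  obtain ⟨i₀, hi₀⟩ := hR
  have hpos : ∀ n i, 0 < L i (y n) + lam i := fun n i => (hy n).1 i
  have hlim : ∀ i, Tendsto (fun n => L i (y n) + lam i) atTop (𝓝 (L i p + lam i)) := fun i =>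
    (((L i).continuous_of_finiteDimensional.tendsto p).comp hyp).add_const _
  set a : ℕ → Fin N → ℝ := fun n i =>
    if L i p + lam i = 0 then -Real.log (L i (y n) + lam i) else 0 with ha
  set b : ℕ → Fin N → ℝ := fun n i =>
    if L i p + lam i = 0 then 0 else Real.log (L i (y n) + lam i) with hb
  have ha_top : ∀ i, L i p + lam i = 0 → Tendsto (fun n => a n i) atTop atTop := by
    intro i hi
    simp only [ha, hi, if_true]
    refine tendsto_neg_atBot_atTop.comp (Real.tendsto_log_nhdsGT_zero.comp ?_)
    exact tendsto_nhdsWithin_iff.mpr ⟨hi ▸ hlim i, Eventually.of_forall fun n => hpos n i⟩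
  have ha_nonneg : ∀ᶠ n in atTop, ∀ i, 0 ≤ a n i := by
    refine eventually_all.mpr fun i => ?_
    by_cases hi : L i p + lam i = 0
    · exact (ha_top i hi).eventually_ge_atTop 0
    · exact Eventually.of_forall fun n => by simp [ha, hi]
  have hsum_top : Tendsto (fun n => ∑ i, a n i) atTop atTop := by
    refine tendsto_atTop_mono' _ ?_ (ha_top i₀ hi₀)
    filter_upwards [ha_nonneg] with n hn
    exact Finset.single_le_sum (fun i _ => hn i) (Finset.mem_univ i₀)
  have hb_lim : ∀ i, ∃ c, Tendsto (fun n => b n i) atTop (𝓝 c) := by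
    intro i
    by_cases hi : L i p + lam i = 0
    · exact ⟨0, by simp [hb, hi]⟩
    · exact ⟨_, by simpa only [hb, hi, if_false] using (hlim i).log hi⟩
  choose c hc using hb_lim
  have hrel : ∀ n k, ∑ i, a n i * (β k i : ℝ) = ∑ i, b n i * (β k i : ℝ) := by
    intro n k
    have h := congrArg Real.log ((hy n).2 k)
    rw [Real.log_prod fun i _ => (zpow_pos (hpos n i) _).ne', Real.log_one] at h
    simp only [Real.log_zpow] at h
    rw [← sub_eq_zero, ← Finset.sum_sub_distrib, ← neg_eq_zero, ← Finset.sum_neg_distrib, ← h]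
    refine Finset.sum_congr rfl fun i _ => ?_
    by_cases hi : L i p + lam i = 0 <;> simp only [ha, hb, hi, if_true, if_false] <;> ring
  have hmem : ∀ᶠ n in atTop, (fun i => a n i / ∑ j, a n j) ∈ stdSimplex ℝ (Fin N) := by
    filter_upwards [ha_nonneg, hsum_top.eventually_gt_atTop 0] with n hn hs
    exact ⟨fun i => div_nonneg (hn i) hs.le, by rw [← Finset.sum_div, div_self hs.ne']⟩
  obtain ⟨α, hα, φ, hφ, hαlim⟩ :=
    (isCompact_stdSimplex ℝ (Fin N)).tendsto_subseq' hmem.frequently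
  have hcoord := tendsto_pi_nhds.mp hαlim
  refine ⟨α, hα.1, fun i hi => ?_, ?_, fun k => ?_⟩
  · refine tendsto_nhds_unique (hcoord i) ?_
    simp [ha, hi]
  · rintro rfl
    simpa using hα.2
  · have h₁ := tendsto_finsetSum Finset.univ fun i _ => (hcoord i).mul_const (β k i : ℝ)
    refine tendsto_nhds_unique h₁ ?_
    have h₂ := (tendsto_finsetSum Finset.univ fun i _ =>
      (hc i).mul_const (β k i : ℝ)).div_atTop hsum_top
    refine (h₂.comp hφ.tendsto_atTop).congr fun n => ?_
    simp only [Function.comp_apply, ← hrel, Finset.sum_div]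
    exact Finset.sum_congr rfl fun i _ => by ring
end

section
/- Let B be a real r×m matrix and define Z := {y ∈ (0,∞)^r : ∏_{t=1}^r y_t^{B_{t,k}} = 1 for all k = 1, …, m}, where the powers are real powers of positive real numbers. Then the closure of Z in ℝ^r contains a point having at least one coordinate equal to 0 if and only if there exists a nonzero vector α ∈ ℝ^r with all coordinates nonnegative such that Σ_{t=1}^r α_t B_{t,k} = 0 for all k = 1, …, m. (For the 'if' direction, the monomial curve t ↦ (t^{α_1}, …, t^{α_r}), t > 0, lies in Z and converges as t → 0⁺ to a point with a zero coordinate.) -/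
open Filter Topology in
/-- If a closed cone of vectors contains vectors that are bounded above by a common constant
in all coordinates while some fixed coordinate is arbitrarily negative, then it contains a nonzero
vector with no positive coordinate. -/
theorem exists_nonpos_of_bddAbove_of_unbounded {ι : Type*} [Fintype ι] {V : Set (ι → ℝ)}
    (hclosed : IsClosed V) (hcone : ∀ c : ℝ, 0 < c → ∀ x ∈ V, c • x ∈ V) (M : ℝ) (i : ι)
    (h : ∀ n : ℕ, ∃ x ∈ V, (∀ t, x t ≤ M) ∧ x i < -(n : ℝ)) :
    ∃ v ∈ V, v ≠ 0 ∧ ∀ t, v t ≤ 0 := by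
  choose x hxV hxM hxi using h
  have hnorm (n : ℕ) : (n : ℝ) < ‖x n‖ := by
    have h₁ := norm_le_pi_norm (x n) i
    have h₂ := neg_abs_le (x n i)
    rw [Real.norm_eq_abs] at h₁
    linarith [hxi n]
  have hpos (n : ℕ) : 0 < ‖x n‖ := n.cast_nonneg.trans_lt (hnorm n)
  have htop : Tendsto (fun n => ‖x n‖) atTop atTop :=
    tendsto_atTop_mono (fun n => (hnorm n).le) tendsto_natCast_atTop_atTop
  have hsphere (n : ℕ) : ‖x n‖⁻¹ • x n ∈ Metric.sphere (0 : ι → ℝ) 1 := by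
    rw [mem_sphere_zero_iff_norm, norm_smul, norm_inv, norm_norm, inv_mul_cancel₀ (hpos n).ne']
  obtain ⟨v, hv, φ, hφ, hlim⟩ := (isCompact_sphere (0 : ι → ℝ) 1).tendsto_subseq hsphere
  refine ⟨v, hclosed.mem_of_tendsto hlim
    (Eventually.of_forall fun n => hcone _ (inv_pos.2 (hpos _)) _ (hxV _)), ?_, fun t => ?_⟩
  · rintro rfl
    simp at hv
  · have hbound : Tendsto (fun n => ‖x (φ n)‖⁻¹ * M) atTop (𝓝 0) := by
      simpa using ((tendsto_inv_atTop_zero.comp htop).comp hφ.tendsto_atTop).mul_const M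
    refine le_of_tendsto_of_tendsto (tendsto_pi_nhds.1 hlim t) hbound
      (Eventually.of_forall fun n => ?_)
    exact mul_le_mul_of_nonneg_left (hxM _ t) (inv_nonneg.2 (norm_nonneg _))

/-- A real monomial in exponentials is the exponential of a linear form. -/
theorem prod_exp_rpow {ι : Type*} [Fintype ι] (x b : ι → ℝ) :
    ∏ t, Real.exp (x t) ^ b t = Real.exp (∑ t, x t * b t) := by
  simp_rw [Real.exp_sum, Real.exp_mul]

open Filter Topology in
/-- The closure of the solution set of a system of monomial equations
(with real exponents) in the positive orthant reaches the coordinate hyperplanes if and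
only if the exponent matrix annihilates a nonzero nonnegative row vector. -/
theorem monomial_closure_meets_boundary_iff
    (r m : ℕ) (B : Matrix (Fin r) (Fin m) ℝ) :
    (∃ p ∈ closure {y : Fin r → ℝ | (∀ t, 0 < y t) ∧
        ∀ k, ∏ t, y t ^ B t k = 1}, ∃ t, p t = 0) ↔
      ∃ α : Fin r → ℝ, α ≠ 0 ∧ (∀ t, 0 ≤ α t) ∧ ∀ k, ∑ t, α t * B t k = 0 := by
  constructor
  · rintro ⟨p, hp, i, hi⟩
    obtain ⟨v, hvV, hv0, hv⟩ := exists_nonpos_of_bddAbove_of_unbounded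
      (V := {x : Fin r → ℝ | ∀ k, ∑ t, x t * B t k = 0})
      (by
        rw [Set.ofPred_forall]
        exact isClosed_iInter fun k => isClosed_eq (by fun_prop) continuous_const)
      (fun c _ x hx k => by simp [mul_assoc, ← Finset.mul_sum, hx k])
      (‖p‖ + 1) i (fun n => by
        obtain ⟨y, ⟨hy, hyB⟩, hyp⟩ := Metric.mem_closure_iff.1 hp _ (Real.exp_pos (-(n : ℝ)))
        have hdist (t : Fin r) : y t < p t + Real.exp (-(n : ℝ)) := by
          have h₁ := (dist_le_pi_dist p y t).trans_lt hyp
          rw [Real.dist_eq] at h₁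
          linarith [(abs_lt.1 h₁).1]
        refine ⟨fun t => Real.log (y t), fun k => ?_, fun t => ?_, ?_⟩
        · rw [← Real.exp_eq_one_iff, ← prod_exp_rpow, ← hyB k]
          exact Finset.prod_congr rfl fun t _ => by rw [Real.exp_log (hy t)]
        · have h₁ : Real.exp (-(n : ℝ)) ≤ 1 := Real.exp_le_one_iff.2 (by simp)
          have h₂ := (le_abs_self (p t)).trans (norm_le_pi_norm p t)
          linarith [hdist t, Real.log_le_sub_one_of_pos (hy t)]
        · rw [Real.log_lt_iff_lt_exp (hy i)]
          simpa [hi] using hdist i)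
    exact ⟨-v, neg_ne_zero.2 hv0, fun t => neg_nonneg.2 (hv t), fun k => by simp [hvV k]⟩
  · rintro ⟨α, hα0, hα, hαB⟩
    obtain ⟨i, hi⟩ := Function.ne_iff.1 hα0
    refine ⟨fun t => if α t = 0 then 1 else 0, ?_, i, if_neg hi⟩
    refine mem_closure_of_tendsto (f := fun (s : ℝ) t => Real.exp (-s * α t)) (b := atTop)
      (tendsto_pi_nhds.2 fun t => ?_)
      (Eventually.of_forall fun s => ⟨fun t => Real.exp_pos _, fun k => ?_⟩)
    · split_ifs with ht
      · simp [ht]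
      · exact Real.tendsto_exp_atBot.comp
          (tendsto_neg_atTop_atBot.atBot_mul_const ((hα t).lt_of_ne' ht))
    · rw [prod_exp_rpow]
      simp_rw [mul_assoc]
      rw [← Finset.mul_sum, hαB k, mul_zero, Real.exp_zero]
end

section
/- Let Λ_i(y) = L_i(y) + λ_i for i = 1, …, N be affine forms on ℝ^ℓ and let β^{(1)}, …, β^{(m)} ∈ ℤ^N. Define Z := {y ∈ ℝ^ℓ : Λ_i(y) > 0 for all i, and ∏_{i=1}^N Λ_i(y)^{β^{(k)}_i} = 1 for all k = 1, …, m}. Let p ∈ ℝ^ℓ be a point with Λ_i(p) ≥ 0 for all i, let R := {i : Λ_i(p) = 0}, and set r := |R|. Suppose r ≥ 1, r ≤ m, and that there is no nonzero nonnegative vector (α_i)_{i∈R} with Σ_{i∈R} α_i β^{(k)}_i = 0 for all k = 1, …, r (i.e., the submatrix of B = (β^{(k)}_i) with rows R and the first r columns annihilates no nonzero nonnegative row vector). Then p does not lie in the closure of Z. In particular, the closure of the solution set of the first m master functions can meet the boundary of the chamber only at points where at least m+1 of the affine forms vanish or where the corresponding square submatrix of B annihilates a nonzero nonnegative row vector.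 -/
open Filter Topology

/-- If at a boundary point p of the chamber exactly the forms indexed by R
vanish, with 1 ≤ r = |R| ≤ m, and the submatrix of the exponent matrix with rows R and the
first r columns annihilates no nonzero nonnegative row vector, then p is not in the closure
of the solution set of the first m master functions in the positive chamber. -/
theorem boundary_point_not_in_closure
    (ℓ N m : ℕ)
    (L : Fin N → (Fin ℓ → ℝ) →ₗ[ℝ] ℝ) (lam : Fin N → ℝ)
    (β : Fin m → Fin N → ℤ)
    (p : Fin ℓ → ℝ) (hp : ∀ i, 0 ≤ L i p + lam i)
    (r : ℕ) (hr : r = {i : Fin N | L i p + lam i = 0}.ncard)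
    (hr1 : 1 ≤ r) (hrm : r ≤ m)
    (hno : ¬ ∃ α : Fin N → ℝ, (∀ i, 0 ≤ α i) ∧ (∀ i, L i p + lam i ≠ 0 → α i = 0) ∧
      α ≠ 0 ∧ ∀ k : Fin m, (k : ℕ) < r → ∑ i, α i * (β k i : ℝ) = 0) :
    p ∉ closure {y : Fin ℓ → ℝ | (∀ i, 0 < L i y + lam i) ∧
      ∀ k, ∏ i, (L i y + lam i) ^ β k i = 1} := by
  classical
  intro hmem
  set Z : Set (Fin ℓ → ℝ) := {y | (∀ i, 0 < L i y + lam i) ∧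
    ∀ k, ∏ i, (L i y + lam i) ^ β k i = 1}
  have hne : (𝓝[Z] p).NeBot := mem_closure_iff_nhdsWithin_neBot.mp hmem
  obtain ⟨i₀, hi₀⟩ : {i : Fin N | L i p + lam i = 0}.Nonempty :=
    Set.nonempty_of_ncard_ne_zero (by omega)
  let U : Ultrafilter (Fin ℓ → ℝ) := Ultrafilter.of (𝓝[Z] p)
  have hU : (U : Filter (Fin ℓ → ℝ)) ≤ 𝓝[Z] p := Ultrafilter.of_le _
  have hUZ : ∀ᶠ y in (U : Filter _), y ∈ Z := hU self_mem_nhdsWithin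
  have hcont : ∀ i, Tendsto (fun y => L i y + lam i) (U : Filter _) (𝓝 (L i p + lam i)) := fun i =>
    (((L i).continuous_of_finiteDimensional.add continuous_const).tendsto p).mono_left
      (hU.trans nhdsWithin_le_nhds)
  let R : Finset (Fin N) := {i | L i p + lam i = 0}
  have hlog : ∀ i ∈ R, Tendsto (fun y => -Real.log (L i y + lam i)) (U : Filter _) atTop := by
    intro i hi
    have hi' : L i p + lam i = 0 := by simpa [R] using hi
    refine tendsto_neg_atBot_atTop.comp (Real.tendsto_log_nhdsGT_zero.comp ?_)
    refine tendsto_nhdsWithin_iff.mpr ⟨hi' ▸ hcont i, ?_⟩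
    filter_upwards [hUZ] with y hy using hy.1 i
  let a : (Fin ℓ → ℝ) → Fin N → ℝ := fun y i => if i ∈ R then -Real.log (L i y + lam i) else 0
  let S : (Fin ℓ → ℝ) → ℝ := fun y => ∑ i, a y i
  have hi₀R : i₀ ∈ R := by simpa [R] using hi₀
  have ha : ∀ᶠ y in (U : Filter _), ∀ i, 0 ≤ a y i := by
    refine eventually_all.mpr fun i => ?_
    by_cases hi : i ∈ R
    · simpa [a, hi] using (hlog i hi).eventually_ge_atTop 0
    · simp [a, hi]
  have hS : Tendsto S (U : Filter _) atTop := by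
    refine tendsto_atTop_mono' _ ?_ (hlog i₀ hi₀R)
    filter_upwards [ha] with y hy
    have := Finset.single_le_sum (fun i _ => hy i) (Finset.mem_univ i₀)
    simpa only [a, hi₀R, if_true] using this
  have hsimplex : ∀ᶠ y in (U : Filter _), (fun i => a y i / S y) ∈ stdSimplex ℝ (Fin N) := by
    filter_upwards [ha, hS.eventually_gt_atTop 0] with y hy hSy
    refine ⟨fun i => div_nonneg (hy i) hSy.le, ?_⟩
    rw [← Finset.sum_div]
    exact div_self hSy.ne'
  obtain ⟨α, hα, hle⟩ := (isCompact_stdSimplex ℝ (Fin N)).ultrafilter_le_nhds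
    (U.map fun y i => a y i / S y) (le_principal_iff.mpr hsimplex)
  have hlim : ∀ i, Tendsto (fun y => a y i / S y) (U : Filter _) (𝓝 (α i)) :=
    tendsto_pi_nhds.mp hle
  refine hno ⟨α, hα.1, fun i hi => ?_, ?_, fun k _ => ?_⟩
  · refine tendsto_nhds_unique (hlim i) ?_
    have : i ∉ R := by simpa [R] using hi
    simp [a, this]
  · rintro rfl
    simpa using hα.2
  · have h₁ : Tendsto (fun y => ∑ i, a y i / S y * (β k i : ℝ)) (U : Filter _)
        (𝓝 (∑ i, α i * (β k i : ℝ))) :=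
      tendsto_finsetSum _ fun i _ => (hlim i).mul_const _
    have h₂ : Tendsto (fun y => ∑ i ∈ Rᶜ, (β k i : ℝ) * Real.log (L i y + lam i)) (U : Filter _)
        (𝓝 (∑ i ∈ Rᶜ, (β k i : ℝ) * Real.log (L i p + lam i))) :=
      tendsto_finsetSum _ fun i hi =>
        ((hcont i).log (by simpa [R] using hi)).const_mul _
    refine tendsto_nhds_unique h₁ ((h₂.div_atTop hS).congr' ?_)
    filter_upwards [hUZ] with y hy
    have hsum : ∑ i, (β k i : ℝ) * Real.log (L i y + lam i) = 0 := by
      have h := congrArg Real.log (hy.2 k)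
      rw [Real.log_prod fun i _ => zpow_ne_zero _ (hy.1 i).ne', Real.log_one] at h
      simpa only [Real.log_zpow] using h
    rw [← Finset.sum_add_sum_compl R] at hsum
    have hR : ∑ i, a y i * (β k i : ℝ) = -∑ i ∈ R, (β k i : ℝ) * Real.log (L i y + lam i) := by
      simp only [a, ite_mul, zero_mul, Finset.sum_ite_mem, Finset.univ_inter,
        ← Finset.sum_neg_distrib]
      exact Finset.sum_congr rfl fun i _ => by ring
    simp only [div_mul_eq_mul_div, ← Finset.sum_div, hR]
    congr 1
    linarith
end
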